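/- Let 𝕜 be a field, q ∈ 𝕜 nonzero and a,b,c ∈ 𝕜, and let B = 𝕜⟨x₁,x₂⟩/⟨x₂x₁ − qx₁x₂ − ax₁ − bx₂ − c⟩ be the bi-quadratic algebra on two generators. Then the images of the monomials x₁^{i}x₂^{j}, (i,j) ∈ ℕ², form a basis of B as a 𝕜-vector space, and B is a left and right Noetherian integral domain. -/

import Mathlib

noncomputable section

open FreeAlgebra

/-- The defining relation of the bi-quadratic algebra on two generators:
`x₂x₁ = qx₁x₂ + ax₁ + bx₂ + c`.  The quotient `RingQuot` of the free algebra by this relation is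
exactly the quotient by the two-sided ideal generated by `x₂x₁ − qx₁x₂ − ax₁ − bx₂ − c`. -/
def BQ2Rel (𝕜 : Type*) [Field 𝕜] (q a b c : 𝕜) :
    FreeAlgebra 𝕜 (Fin 2) → FreeAlgebra 𝕜 (Fin 2) → Prop := fun u v =>
  u = ι 𝕜 (1 : Fin 2) * ι 𝕜 (0 : Fin 2) ∧
    v = q • (ι 𝕜 (0 : Fin 2) * ι 𝕜 (1 : Fin 2)) + a • ι 𝕜 (0 : Fin 2) + b • ι 𝕜 (1 : Fin 2) +
      algebraMap 𝕜 (FreeAlgebra 𝕜 (Fin 2)) c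

/-- The bi-quadratic algebra on two generators `𝕜[x₁,x₂;q,a,b,c]`. -/
abbrev BQ2 (𝕜 : Type*) [Field 𝕜] (q a b c : 𝕜) : Type _ :=
  RingQuot (BQ2Rel 𝕜 q a b c)

/-- The images of the two generators. -/
def BQ2x (𝕜 : Type*) [Field 𝕜] (q a b c : 𝕜) (i : Fin 2) : BQ2 𝕜 q a b c :=
  RingQuot.mkAlgHom 𝕜 (BQ2Rel 𝕜 q a b c) (ι 𝕜 i)

section TriangularBasis

open Module

variable {K A Γ Λ : Type*} [Field K] [Ring A] [Algebra K A]

/-- The span of the vectors `v γ` of weight less than `s`. -/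
def spanBelow (K : Type*) {A Γ Λ : Type*} [Field K] [Ring A] [Algebra K A] [LT Λ]
    (wt : Γ → Λ) (v : Γ → A) (s : Λ) : Submodule K A :=
  Submodule.span K (Set.image v {γ | wt γ < s})

/-- Products of the `v α` are nonzero multiples of `v (α + β)` up to terms of lower weight. -/
def IsTriangularMul (K : Type*) {A Γ Λ : Type*} [Field K] [Ring A] [Algebra K A] [LT Λ] [Add Γ]
    (wt : Γ → Λ) (v : Γ → A) : Prop :=
  ∀ α β, ∃ k : K, k ≠ 0 ∧ v α * v β - k • v (α + β) ∈ spanBelow K wt v (wt (α + β))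

theorem mem_spanBelow [LT Λ] {wt : Γ → Λ} {v : Γ → A} {γ : Γ} {s : Λ} (h : wt γ < s) :
    v γ ∈ spanBelow K wt v s :=
  Submodule.subset_span ⟨γ, h, rfl⟩

theorem spanBelow_mono [Preorder Λ] {wt : Γ → Λ} {v : Γ → A} {s t : Λ} (h : s ≤ t) :
    spanBelow K wt v s ≤ spanBelow K wt v t :=
  Submodule.span_mono (Set.image_mono fun _ hγ => lt_of_lt_of_le hγ h)

theorem spanBelow_induction [LT Λ] {wt : Γ → Λ} {v : Γ → A} {s : Λ} {P : Submodule K A}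
    (f : A →ₗ[K] A) (h : ∀ γ, wt γ < s → f (v γ) ∈ P) {x : A} (hx : x ∈ spanBelow K wt v s) :
    f x ∈ P := by
  have : spanBelow K wt v s ≤ P.comap f := by
    refine Submodule.span_le.2 ?_
    rintro _ ⟨γ, hγ, rfl⟩
    exact h γ hγ
  exact this hx

theorem IsTriangularMul.op [LT Λ] [AddCommMagma Γ] {wt : Γ → Λ} {v : Γ → A}
    (h : IsTriangularMul K wt v) :
    IsTriangularMul K wt (fun γ => MulOpposite.op (v γ)) := by
  intro α β
  obtain ⟨k, hk, hmem⟩ := h β α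
  refine ⟨k, hk, ?_⟩
  have := Submodule.mem_map_of_mem (f := (MulOpposite.opLinearEquiv K : A ≃ₗ[K] Aᵐᵒᵖ).toLinearMap)
    hmem
  rw [spanBelow, Submodule.map_span, ← Set.image_comp] at this
  rw [add_comm α β]
  exact this

variable [AddCommMonoid Γ] [AddCommMonoid Λ] [LinearOrder Λ] {wt : Γ →+ Λ}

theorem IsTriangularMul.mul_mem_spanBelow {v : Γ → A} (h : IsTriangularMul K wt v) {α β : Γ}
    {s : Λ} (hs : wt α + wt β < s) : v α * v β ∈ spanBelow K wt v s := by
  obtain ⟨k, -, hk⟩ := h α β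
  rw [← map_add] at hs
  have := add_mem (spanBelow_mono hs.le hk) (Submodule.smul_mem _ k (mem_spanBelow hs))
  simpa using this

/-- `x` has leading term `k • v α`. -/
def HasLeading (wt : Γ →+ Λ) (v : Γ → A) (x : A) (α : Γ) (k : K) : Prop :=
  k ≠ 0 ∧ x - k • v α ∈ spanBelow K wt v (wt α)

theorem HasLeading.mul [IsOrderedCancelAddMonoid Λ] {v : Γ → A} (h : IsTriangularMul K wt v) {x y : A} {α β : Γ} {k l : K}
    (hx : HasLeading wt v x α k) (hy : HasLeading wt v y β l) :
    ∃ m : K, HasLeading wt v (x * y) (α + β) m := by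
  obtain ⟨c, hc, hαβ⟩ := h α β
  refine ⟨k * l * c, mul_ne_zero (mul_ne_zero hx.1 hy.1) hc, ?_⟩
  have hleft : ∀ γ, wt γ ≤ wt α → v γ * (y - l • v β) ∈ spanBelow K wt v (wt (α + β)) :=
    fun γ hγ => spanBelow_induction (LinearMap.mulLeft K (v γ))
      (fun δ hδ => h.mul_mem_spanBelow (by rw [map_add]; exact add_lt_add_of_le_of_lt hγ hδ)) hy.2
  have hright : (x - k • v α) * y ∈ spanBelow K wt v (wt (α + β)) := by
    refine spanBelow_induction (LinearMap.mulRight K y) (fun γ hγ => ?_) hx.2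
    have := add_mem (hleft γ hγ.le) (Submodule.smul_mem _ l (h.mul_mem_spanBelow (α := γ) (β := β)
      (by rw [map_add]; exact add_lt_add_left hγ _)))
    simpa [mul_sub] using this
  have := add_mem (add_mem hright (Submodule.smul_mem _ k (hleft α le_rfl)))
    (Submodule.smul_mem _ (k * l) hαβ)
  convert this using 1
  simp only [sub_mul, mul_sub, smul_mul_assoc, mul_smul_comm, smul_sub, smul_smul]
  abel

variable (b : Basis Γ K A)

theorem HasLeading.ne_zero {x : A} {α : Γ} {k : K} (hx : HasLeading wt b x α k) : x ≠ 0 := by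
  rintro rfl
  have h0 : b α ∈ spanBelow K wt b (wt α) := by
    have := Submodule.smul_mem _ (-k⁻¹) hx.2
    simpa [smul_smul, hx.1] using this
  exact b.linearIndependent.notMem_span_image (lt_irrefl (wt α)) h0

theorem exists_hasLeading (hwt : Function.Injective wt) {x : A} (hx : x ≠ 0) :
    ∃ (α : Γ) (k : K), HasLeading wt b x α k := by
  classical
  obtain ⟨α, hα, hmax⟩ := (b.repr x).support.exists_max_image wt
    (Finsupp.support_nonempty_iff.2 (by simpa using hx))
  refine ⟨α, b.repr x α, Finsupp.mem_support_iff.1 hα, ?_⟩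
  have hsum : x - b.repr x α • b α = ∑ γ ∈ (b.repr x).support.erase α, b.repr x γ • b γ := by
    rw [Finset.sum_erase_eq_sub hα]
    congr 1
    exact (b.linearCombination_repr x).symm
  rw [hsum]
  refine Submodule.sum_mem _ fun γ hγ => Submodule.smul_mem _ _ (mem_spanBelow ?_)
  exact lt_of_le_of_ne (hmax γ (Finset.mem_of_mem_erase hγ))
    (hwt.ne (Finset.ne_of_mem_erase hγ))

theorem HasLeading.lt_of_mem_spanBelow {x : A} {α : Γ} {k : K} {s : Λ}
    (hx : HasLeading wt b x α k) (hs : x ∈ spanBelow K wt b s) : wt α < s := by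
  by_contra! hle
  have h0 : HasLeading wt b (0 : A) α (-k) := by
    refine ⟨neg_ne_zero.2 hx.1, ?_⟩
    have := sub_mem (spanBelow_mono hle hs) hx.2
    simpa using this
  exact h0.ne_zero b rfl

theorem isDomain_of_isTriangularMul [IsOrderedCancelAddMonoid Λ] (hwt : Function.Injective wt)
    (h : IsTriangularMul K wt b) : IsDomain A := by
  have : Nontrivial A := ⟨b 0, 0, b.ne_zero 0⟩
  have : NoZeroDivisors A := by
    refine ⟨fun {x y} hxy => ?_⟩
    by_contra! hne
    obtain ⟨α, k, hx⟩ := exists_hasLeading b hwt hne.1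
    obtain ⟨β, l, hy⟩ := exists_hasLeading b hwt hne.2
    obtain ⟨m, hm⟩ := hx.mul h hy
    exact hm.ne_zero b hxy
  exact NoZeroDivisors.to_isDomain A

theorem isNoetherianRing_of_isTriangularMul [PartialOrder Γ] [CanonicallyOrderedAdd Γ]
    [WellQuasiOrderedLE Γ] [IsOrderedCancelAddMonoid Λ] [WellFoundedLT Λ]
    (hwt : Function.Injective wt) (h : IsTriangularMul K wt b) : IsNoetherianRing A := by
  refine (isNoetherianRing_iff_ideal_fg A).2 fun I => ?_
  set P : Γ → Prop := fun α => ∃ x ∈ I, ∃ k : K, HasLeading wt b x α k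
  have hfin : {α | Minimal P α}.Finite :=
    WellQuasiOrderedLE.finite_of_isAntichain (setOfPred_minimal_antichain P)
  choose! g hgI hg using fun (α : Γ) (hα : Minimal P α) => hα.prop
  have hJI : Ideal.span (g '' {α | Minimal P α}) ≤ I := by
    refine Ideal.span_le.2 ?_
    rintro _ ⟨α, hα, rfl⟩
    exact hgI α hα
  suffices hIJ : I ≤ Ideal.span (g '' {α | Minimal P α}) by
    rw [le_antisymm hIJ hJI]
    exact Submodule.fg_span (hfin.image g)
  suffices key : ∀ s : Λ, ∀ x ∈ I, ∀ (α : Γ) (k : K), wt α = s → HasLeading wt b x α k →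
      x ∈ Ideal.span (g '' {α | Minimal P α}) by
    intro x hx
    rcases eq_or_ne x 0 with rfl | hx0
    · exact zero_mem _
    · obtain ⟨α, k, hα⟩ := exists_hasLeading b hwt hx0
      exact key _ x hx α k rfl hα
  intro s
  induction s using WellFoundedLT.induction with
  | ind s ih =>
    rintro x hxI α k rfl hx
    obtain ⟨β, hβα, hβ⟩ := exists_minimal_le_of_wellFoundedLT P α ⟨x, hxI, k, hx⟩
    obtain ⟨γ, rfl⟩ := exists_add_of_le hβα
    obtain ⟨l, hl⟩ := hg β hβ
    obtain ⟨m, hm⟩ := HasLeading.mul h (x := b γ) (α := γ) (k := 1)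
      ⟨one_ne_zero, by simp⟩ hl
    rw [add_comm γ β] at hm
    have hgJ : (k / m) • (b γ * g β) ∈ Ideal.span (g '' {α | Minimal P α}) := by
      rw [← smul_mul_assoc]
      exact Ideal.mul_mem_left _ _ (Ideal.subset_span ⟨β, hβ, rfl⟩)
    have hlow : x - (k / m) • (b γ * g β) ∈ spanBelow K wt b (wt (β + γ)) := by
      have := sub_mem hx.2 (Submodule.smul_mem _ (k / m) hm.2)
      rw [smul_sub, smul_smul, div_mul_cancel₀ _ hm.1] at this
      simpa using this
    rcases eq_or_ne (x - (k / m) • (b γ * g β)) 0 with h0 | h0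
    · rwa [sub_eq_zero.1 h0]
    · obtain ⟨δ, n, hδ⟩ := exists_hasLeading b hwt h0
      have := ih (wt δ) (hδ.lt_of_mem_spanBelow b hlow) _ (sub_mem hxI (hJI hgJ)) δ n rfl hδ
      simpa using add_mem this hgJ

end TriangularBasis

section OrderedMonomials

variable {K A : Type*} [Field K] [Ring A] [Algebra K A]

/-- The weight of the exponent `(i, j)`: lexicographic, the second exponent first. -/
def revLexWeight : ℕ × ℕ →+ ℕ ×ₗ ℕ where
  toFun m := toLex m.swap
  map_zero' := rfl
  map_add' _ _ := rfl

theorem revLexWeight_injective : Function.Injective revLexWeight :=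
  toLex.injective.comp Prod.swap_injective

theorem revLexWeight_lt_iff {m n : ℕ × ℕ} :
    revLexWeight m < revLexWeight n ↔ m.2 < n.2 ∨ m.2 = n.2 ∧ m.1 < n.1 :=
  Prod.Lex.toLex_lt_toLex

/-- The ordered monomials in two elements `x`, `y`. -/
def orderedMonomial (x y : A) (m : ℕ × ℕ) : A := x ^ m.1 * y ^ m.2

theorem pow_mul_mul_pow_mem_spanBelow {x y u : A} {m : ℕ × ℕ}
    (hu : u ∈ spanBelow K revLexWeight (orderedMonomial x y) (revLexWeight m)) (i j : ℕ) :
    x ^ i * u * y ^ j ∈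
      spanBelow K revLexWeight (orderedMonomial x y) (revLexWeight (m.1 + i, m.2 + j)) := by
  refine spanBelow_induction ((LinearMap.mulRight K (y ^ j)).comp (LinearMap.mulLeft K (x ^ i)))
    (fun n hn => ?_) hu
  have hmul : x ^ i * orderedMonomial x y n * y ^ j = orderedMonomial x y (n.1 + i, n.2 + j) := by
    simp only [orderedMonomial, pow_add, mul_assoc, (Commute.refl x).pow_pow n.1 i |>.eq]
  have hlt : revLexWeight (n.1 + i, n.2 + j) < revLexWeight (m.1 + i, m.2 + j) := by
    rw [revLexWeight_lt_iff] at hn ⊢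
    dsimp only
    omega
  simpa [hmul] using mem_spanBelow (K := K) (v := orderedMonomial x y) hlt

variable {x y : A} {q a b c : K}

theorem mul_pow_sub_mem_spanBelow
    (h : y * x = q • (x * y) + a • x + b • y + algebraMap K A c) (k : ℕ) :
    y * x ^ k - q ^ k • (x ^ k * y) ∈
      spanBelow K revLexWeight (orderedMonomial x y) (revLexWeight (k, 1)) := by
  induction k with
  | zero => simp
  | succ k ih =>
    have hmono : spanBelow K revLexWeight (orderedMonomial x y) (revLexWeight (k, 1)) ≤
        spanBelow K revLexWeight (orderedMonomial x y) (revLexWeight (k + 1, 1)) :=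
      spanBelow_mono (revLexWeight_lt_iff.2 (by simp)).le
    have hmem : ∀ m : ℕ × ℕ, m.2 < 1 ∨ m.2 = 1 ∧ m.1 < k + 1 → orderedMonomial x y m ∈
        spanBelow K revLexWeight (orderedMonomial x y) (revLexWeight (k + 1, 1)) :=
      fun m hm => mem_spanBelow (revLexWeight_lt_iff.2 hm)
    have h₁ := pow_mul_mul_pow_mem_spanBelow ih 1 0
    have h₂ := hmem (k + 1, 0) (by simp)
    have h₃ := hmem (k, 1) (by simp)
    have h₄ := hmem (k, 0) (by simp)
    simp only [orderedMonomial, pow_zero, mul_one, pow_one] at h₁ h₂ h₃ h₄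
    have := add_mem (add_mem (add_mem (add_mem (Submodule.smul_mem _ q h₁)
      (Submodule.smul_mem _ a h₂)) (Submodule.smul_mem _ b (hmono ih)))
      (Submodule.smul_mem _ (b * q ^ k) h₃)) (Submodule.smul_mem _ c h₄)
    convert this using 1
    rw [pow_succ' x, ← mul_assoc, h, Algebra.algebraMap_eq_smul_one]
    simp only [add_mul, mul_sub, smul_mul_assoc, mul_smul_comm, smul_sub, smul_smul, mul_assoc,
      one_mul, pow_succ' q]
    abel

theorem pow_mul_pow_sub_mem_spanBelow
    (h : y * x = q • (x * y) + a • x + b • y + algebraMap K A c) (j k : ℕ) :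
    y ^ j * x ^ k - q ^ (j * k) • (x ^ k * y ^ j) ∈
      spanBelow K revLexWeight (orderedMonomial x y) (revLexWeight (k, j)) := by
  have hstep : ∀ i j : ℕ, y * (x ^ i * y ^ j) - q ^ i • (x ^ i * y ^ (j + 1)) ∈
      spanBelow K revLexWeight (orderedMonomial x y) (revLexWeight (i, j + 1)) := by
    intro i j
    have := pow_mul_mul_pow_mem_spanBelow (mul_pow_sub_mem_spanBelow h i) 0 j
    simpa [sub_mul, mul_assoc, pow_succ', add_comm] using this
  induction j with
  | zero => simp
  | succ j ih =>
    have hlow : y * (y ^ j * x ^ k - q ^ (j * k) • (x ^ k * y ^ j)) ∈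
        spanBelow K revLexWeight (orderedMonomial x y) (revLexWeight (k, j + 1)) := by
      refine spanBelow_induction (LinearMap.mulLeft K y) (fun m hm => ?_) ih
      have hlt : revLexWeight (m.1, m.2 + 1) < revLexWeight (k, j + 1) := by
        rw [revLexWeight_lt_iff] at hm ⊢
        simpa using hm
      have := add_mem (spanBelow_mono hlt.le (hstep m.1 m.2))
        (Submodule.smul_mem _ (q ^ m.1) (mem_spanBelow (v := orderedMonomial x y) hlt))
      simpa [orderedMonomial] using this
    have := add_mem hlow (Submodule.smul_mem _ (q ^ (j * k)) (hstep k j))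
    convert this using 1
    simp only [mul_sub, smul_sub, smul_smul, mul_smul_comm, add_mul, one_mul, pow_add,
      pow_succ' y, mul_assoc]
    abel

theorem isTriangularMul_orderedMonomial (hq : q ≠ 0)
    (h : y * x = q • (x * y) + a • x + b • y + algebraMap K A c) :
    IsTriangularMul K revLexWeight (orderedMonomial x y) := by
  intro m n
  refine ⟨q ^ (m.2 * n.1), pow_ne_zero _ hq, ?_⟩
  have hmem := pow_mul_mul_pow_mem_spanBelow (pow_mul_pow_sub_mem_spanBelow h m.2 n.1) m.1 n.2
  have hmn : (n.1 + m.1, m.2 + n.2) = m + n := Prod.ext (add_comm _ _) rfl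
  rw [hmn] at hmem
  convert hmem using 1
  simp only [orderedMonomial, mul_sub, sub_mul, mul_smul_comm, smul_mul_assoc, Prod.fst_add,
    Prod.snd_add, pow_add, mul_assoc]

theorem adjoin_le_span_orderedMonomial (h : IsTriangularMul K revLexWeight (orderedMonomial x y)) :
    Subalgebra.toSubmodule (Algebra.adjoin K {x, y}) ≤
      Submodule.span K (Set.range (orderedMonomial x y)) := by
  have hmem : ∀ m, orderedMonomial x y m ∈ Submodule.span K (Set.range (orderedMonomial x y)) :=
    fun m => Submodule.subset_span ⟨m, rfl⟩
  have hmul : Submodule.span K (Set.range (orderedMonomial x y)) *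
      Submodule.span K (Set.range (orderedMonomial x y)) ≤
      Submodule.span K (Set.range (orderedMonomial x y)) := by
    rw [Submodule.span_mul_span, Submodule.span_le]
    rintro _ ⟨_, ⟨m, rfl⟩, _, ⟨n, rfl⟩, rfl⟩
    obtain ⟨k, -, hk⟩ := h m n
    have hle := Submodule.span_mono (R := K) (Set.image_subset_range (orderedMonomial x y)
      {γ | revLexWeight γ < revLexWeight (m + n)}) hk
    simpa using add_mem hle (Submodule.smul_mem _ k (hmem (m + n)))
  let S : Subalgebra K A := (Submodule.span K (Set.range (orderedMonomial x y))).toSubalgebra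
    (by simpa [orderedMonomial] using hmem (0, 0))
    (fun u v hu hv => hmul (Submodule.mul_mem_mul hu hv))
  have hS : Algebra.adjoin K {x, y} ≤ S := by
    refine Algebra.adjoin_le ?_
    rintro u (rfl | rfl)
    · exact (by simpa [orderedMonomial] using hmem (1, 0) :
        u ∈ Submodule.span K (Set.range (orderedMonomial u y)))
    · exact (by simpa [orderedMonomial] using hmem (0, 1) :
        u ∈ Submodule.span K (Set.range (orderedMonomial x u)))
  exact hS

end OrderedMonomials

section OreRepresentation

open Polynomial

variable {𝕜 : Type*} [Field 𝕜] (q a b c : 𝕜)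

/-- The algebra map sending `p` to the matrix `!![σ p, δ p; 0, p]`, where `σ` is the endomorphism
`X ↦ q X + b` and `δ` is the `σ`-derivation with `δ X = a X + c`. -/
def oreMatrix : 𝕜[X] →ₐ[𝕜] Matrix (Fin 2) (Fin 2) 𝕜[X] :=
  aeval !![C q * X + C b, C a * X + C c; 0, X]

/-- Multiplication by the Ore variable on the free left `𝕜[X]`-module of Ore polynomials
`∑ pⱼ Yʲ`. -/
def oreShift : (ℕ →₀ 𝕜[X]) →ₗ[𝕜] (ℕ →₀ 𝕜[X]) :=
  Finsupp.lsum 𝕜 fun j =>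
    (Finsupp.lsingle (j + 1)).comp ((Matrix.entryLinearMap 𝕜 𝕜[X] 0 0).comp
        (oreMatrix q a b c).toLinearMap) +
      (Finsupp.lsingle j).comp ((Matrix.entryLinearMap 𝕜 𝕜[X] 0 1).comp
        (oreMatrix q a b c).toLinearMap)

/-- Multiplication by `X` on Ore polynomials. -/
def oreMulX : (ℕ →₀ 𝕜[X]) →ₗ[𝕜] (ℕ →₀ 𝕜[X]) :=
  Finsupp.mapRange.linearMap (LinearMap.mulLeft 𝕜 X)

theorem oreMatrix_lower (p : 𝕜[X]) :
    oreMatrix q a b c p 1 0 = 0 ∧ oreMatrix q a b c p 1 1 = p := by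
  induction p using Polynomial.induction_on' with
  | add p r hp hr => simp [map_add, hp.1, hp.2, hr.1, hr.2]
  | monomial n k =>
    induction n with
    | zero => simp [oreMatrix, Matrix.algebraMap_matrix_apply]
    | succ n ih =>
      have hX : oreMatrix q a b c X = !![C q * X + C b, C a * X + C c; 0, X] := by
        simp [oreMatrix]
      rw [← monomial_mul_X, map_mul, hX]
      simp [Matrix.mul_apply, Fin.sum_univ_two, ih.1, ih.2]

theorem oreShift_single (j : ℕ) (p : 𝕜[X]) :
    oreShift q a b c (Finsupp.single j p) =
      Finsupp.single (j + 1) (oreMatrix q a b c p 0 0) +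
        Finsupp.single j (oreMatrix q a b c p 0 1) := by
  simp [oreShift]

theorem oreMulX_single (j : ℕ) (p : 𝕜[X]) :
    oreMulX (Finsupp.single j p) = Finsupp.single j (X * p) := by
  simp [oreMulX]

theorem oreShift_mul_oreMulX :
    oreShift q a b c * oreMulX = q • (oreMulX * oreShift q a b c) + a • oreMulX +
      b • oreShift q a b c + algebraMap 𝕜 (Module.End 𝕜 (ℕ →₀ 𝕜[X])) c := by
  refine Finsupp.lhom_ext fun j p => ?_
  have hX : oreMatrix q a b c X = !![C q * X + C b, C a * X + C c; 0, X] := by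
    simp [oreMatrix]
  simp only [Module.End.mul_apply, LinearMap.add_apply, LinearMap.smul_apply, oreMulX_single,
    oreShift_single, map_add, map_mul, hX, Module.algebraMap_end_apply, Finsupp.smul_single,
    smul_add, Matrix.mul_apply, Fin.sum_univ_two, (oreMatrix_lower q a b c p).1,
    (oreMatrix_lower q a b c p).2, smul_eq_C_mul]
  ext i : 1
  simp only [Finsupp.add_apply, Finsupp.single_apply]
  split_ifs <;> simp <;> ring

theorem oreMulX_pow_mul_oreShift_pow (i j : ℕ) :
    ((oreMulX : Module.End 𝕜 (ℕ →₀ 𝕜[X])) ^ i * oreShift q a b c ^ j) (Finsupp.single 0 1) =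
      Finsupp.single j (X ^ i) := by
  have hY : (oreShift q a b c ^ j) (Finsupp.single 0 1) = Finsupp.single j 1 := by
    induction j with
    | zero => simp
    | succ j ih =>
      rw [pow_succ', Module.End.mul_apply, ih, oreShift_single]
      simp
  rw [Module.End.mul_apply, hY]
  induction i with
  | zero => simp
  | succ i ih => rw [pow_succ', Module.End.mul_apply, ih, oreMulX_single, pow_succ']

theorem linearIndependent_single_X_pow :
    LinearIndependent 𝕜 fun m : ℕ × ℕ => (Finsupp.single m.2 (X ^ m.1) : ℕ →₀ 𝕜[X]) := by
  have h := (Finsupp.basis fun _ : ℕ => Polynomial.basisMonomials 𝕜).linearIndependent.comp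
    (fun m : ℕ × ℕ => (⟨m.2, m.1⟩ : Σ _ : ℕ, ℕ)) (fun m n hmn => by
      simp only [Sigma.mk.injEq, heq_eq_eq] at hmn
      exact Prod.ext hmn.2 hmn.1)
  convert h using 1
  ext1 m
  simp [Finsupp.coe_basis, monomial_one_right_eq_X_pow]

end OreRepresentation

section BiquadraticAlgebra

variable {𝕜 : Type*} [Field 𝕜] (q a b c : 𝕜)

theorem BQ2x_one_mul_zero :
    BQ2x 𝕜 q a b c 1 * BQ2x 𝕜 q a b c 0 =
      q • (BQ2x 𝕜 q a b c 0 * BQ2x 𝕜 q a b c 1) + a • BQ2x 𝕜 q a b c 0 +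
        b • BQ2x 𝕜 q a b c 1 + algebraMap 𝕜 (BQ2 𝕜 q a b c) c := by
  have := RingQuot.mkAlgHom_rel 𝕜 (s := BQ2Rel 𝕜 q a b c) ⟨rfl, rfl⟩
  simpa [BQ2x] using this

theorem adjoin_BQ2x : Algebra.adjoin 𝕜 {BQ2x 𝕜 q a b c 0, BQ2x 𝕜 q a b c 1} = ⊤ := by
  have hrange : (RingQuot.mkAlgHom 𝕜 (BQ2Rel 𝕜 q a b c)) '' Set.range (ι 𝕜) =
      {BQ2x 𝕜 q a b c 0, BQ2x 𝕜 q a b c 1} := by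
    rw [← Set.range_comp]
    ext u
    simp [Fin.exists_fin_two, BQ2x, eq_comm]
  rw [← hrange, Algebra.adjoin_image, FreeAlgebra.adjoin_range_ι, Algebra.map_top]
  exact (AlgHom.range_eq_top _).2 (RingQuot.mkAlgHom_surjective 𝕜 _)

/-- The action of the bi-quadratic algebra on Ore polynomials. -/
def oreRepresentation : BQ2 𝕜 q a b c →ₐ[𝕜] Module.End 𝕜 (ℕ →₀ Polynomial 𝕜) :=
  RingQuot.liftAlgHom 𝕜 ⟨FreeAlgebra.lift 𝕜 ![oreMulX, oreShift q a b c], by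
    rintro _ _ ⟨rfl, rfl⟩
    simpa using oreShift_mul_oreMulX q a b c⟩

theorem linearIndependent_orderedMonomial_BQ2x :
    LinearIndependent 𝕜 (orderedMonomial (BQ2x 𝕜 q a b c 0) (BQ2x 𝕜 q a b c 1)) := by
  refine LinearIndependent.of_comp
    ((LinearMap.applyₗ (Finsupp.single 0 1)).comp (oreRepresentation q a b c).toLinearMap) ?_
  convert! linearIndependent_single_X_pow (𝕜 := 𝕜) using 1
  ext1 m
  rw [← oreMulX_pow_mul_oreShift_pow q a b c]
  simp [orderedMonomial, oreRepresentation, BQ2x]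

end BiquadraticAlgebra

/-- The bi-quadratic algebra on two generators has PBW basis `x₁^i x₂^j` and is a left and right
Noetherian domain. -/
theorem biquadratic2_pbw_noetherian_domain (𝕜 : Type*) [Field 𝕜] (q a b c : 𝕜)
    (hq : q ≠ 0) :
    (LinearIndependent 𝕜 (fun m : ℕ × ℕ =>
        BQ2x 𝕜 q a b c 0 ^ m.1 * BQ2x 𝕜 q a b c 1 ^ m.2) ∧
      Submodule.span 𝕜 (Set.range (fun m : ℕ × ℕ =>
        BQ2x 𝕜 q a b c 0 ^ m.1 * BQ2x 𝕜 q a b c 1 ^ m.2)) = ⊤) ∧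
    IsDomain (BQ2 𝕜 q a b c) ∧
    IsNoetherianRing (BQ2 𝕜 q a b c) ∧
    IsNoetherianRing (BQ2 𝕜 q a b c)ᵐᵒᵖ := by
  have htri := isTriangularMul_orderedMonomial hq (BQ2x_one_mul_zero q a b c)
  have hli := linearIndependent_orderedMonomial_BQ2x q a b c
  have hspan : ⊤ ≤ Submodule.span 𝕜
      (Set.range (orderedMonomial (BQ2x 𝕜 q a b c 0) (BQ2x 𝕜 q a b c 1))) := by
    have := adjoin_le_span_orderedMonomial htri
    rwa [adjoin_BQ2x, Algebra.top_toSubmodule] at this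
  let B := Module.Basis.mk hli hspan
  have hcoe : ⇑B = orderedMonomial (BQ2x 𝕜 q a b c 0) (BQ2x 𝕜 q a b c 1) :=
    Module.Basis.coe_mk hli hspan
  rw [← hcoe] at htri
  refine ⟨⟨hli, top_le_iff.1 hspan⟩, isDomain_of_isTriangularMul B revLexWeight_injective htri,
    isNoetherianRing_of_isTriangularMul B revLexWeight_injective htri,
    isNoetherianRing_of_isTriangularMul (B.map (MulOpposite.opLinearEquiv 𝕜))
      revLexWeight_injective ?_⟩
  exact htri.op
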